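/- arXiv:1305.6014 — 2 statements merged into one kernel-verified Lean document; each statement's English description precedes it below -/
import Mathlib

section
/- Let B → K and C → K be ring homomorphisms with C → K surjective, A = B ×_K C, and let A → A' be a ring homomorphism such that A' is flat as an A-module. If B ⊗_A A' is a finitely presented B-algebra and C ⊗_A A' is a finitely presented C-algebra, then A' is a finitely presented A-algebra. -/
open TensorProduct

section BaseChange

variable {A : Type*} [CommRing A] (R : Type*) [CommRing R] [Algebra A R]

/-- If `R ⊗[A] f` is surjective, then `R ⊗[A] coker f = 0`. -/
lemma LinearMap.subsingleton_tensorProduct_quotient_range {M N : Type*} [AddCommGroup M]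
    [AddCommGroup N] [Module A M] [Module A N] (f : M →ₗ[A] N)
    (hf : Function.Surjective (f.lTensor R)) :
    Subsingleton (R ⊗[A] (N ⧸ LinearMap.range f)) := by
  refine subsingleton_of_forall_eq 0 fun x ↦ ?_
  obtain ⟨y, rfl⟩ := LinearMap.lTensor_surjective R (Submodule.mkQ_surjective _) x
  obtain ⟨z, rfl⟩ := hf y
  rw [← LinearMap.lTensor_comp_apply, LinearMap.range_mkQ_comp, LinearMap.lTensor_zero,
    LinearMap.zero_apply]

/-- If `f` is a surjection onto a flat module and `R ⊗[A] f` is injective,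
then `R ⊗[A] ker f = 0`. -/
lemma LinearMap.subsingleton_tensorProduct_ker {M N : Type*} [AddCommGroup M]
    [AddCommGroup N] [Module A M] [Module A N] [Module.Flat A N] (f : M →ₗ[A] N)
    (hf : Function.Surjective f) (hinj : Function.Injective (f.lTensor R)) :
    Subsingleton (R ⊗[A] LinearMap.ker f) := by
  have hi := LinearMap.lTensor_injective_of_exact_of_flat f hf (LinearMap.ker f).subtype
    (Submodule.injective_subtype _) f.exact_subtype_ker_map R
  refine subsingleton_of_forall_eq 0 fun x ↦ hi (hinj ?_)
  rw [← LinearMap.lTensor_comp_apply, LinearMap.comp_ker_subtype]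
  simp

variable {S : Type*} [CommRing S] [Algebra A S]

lemma Subalgebra.lTensor_val_surjective_mono {T U : Subalgebra A S} (h : T ≤ U)
    (hT : Function.Surjective (T.val.toLinearMap.lTensor R)) :
    Function.Surjective (U.val.toLinearMap.lTensor R) := by
  intro x
  obtain ⟨y, rfl⟩ := hT x
  exact ⟨(Subalgebra.inclusion h).toLinearMap.lTensor R y, by
    rw [← LinearMap.lTensor_comp_apply]; rfl⟩

/-- If `R ⊗[A] S` is of finite type over `R`, it is generated by a finitely generated
subalgebra of `S`. -/
lemma Algebra.FiniteType.exists_subalgebra_fg_lTensor_surjective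
    [Algebra.FiniteType R (R ⊗[A] S)] :
    ∃ T : Subalgebra A S, T.FG ∧ Function.Surjective (T.val.toLinearMap.lTensor R) := by
  obtain ⟨s, hs⟩ := Algebra.FiniteType.out (R := R) (A := R ⊗[A] S)
  choose k t m h using fun x : s ↦ TensorProduct.exists_sum_tmul_eq x.1
  let v : (Σ x : s, Fin (k x)) → S := fun p ↦ m p.1 p.2
  let T := Algebra.adjoin A (Set.range v)
  refine ⟨T, Subalgebra.fg_def.mpr ⟨_, Set.finite_range v, rfl⟩, ?_⟩
  have hT : Function.Surjective (Algebra.TensorProduct.map (.id R R) T.val) := by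
    rw [← AlgHom.range_eq_top, _root_.eq_top_iff, ← hs, Algebra.adjoin_le_iff]
    intro x hx
    let i : s := ⟨x, hx⟩
    refine ⟨∑ j : Fin (k i), t i j ⊗ₜ ⟨m i j, Algebra.subset_adjoin ⟨⟨i, j⟩, rfl⟩⟩, ?_⟩
    simp [← h, i]
  exact hT

/-- For a surjection `f : P → S` from a finitely presented `A`-algebra such that `R ⊗[A] S` is
finitely presented over `R`, the kernel of `R ⊗[A] f` is generated by a finitely generated
ideal contained in the kernel of `f`. -/
lemma Algebra.FinitePresentation.exists_fg_le_ker_map_includeRight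
    {P : Type*} [CommRing P] [Algebra A P] [Algebra.FinitePresentation A P]
    [Algebra.FinitePresentation R (R ⊗[A] S)] (f : P →ₐ[A] S) (hf : Function.Surjective f) :
    ∃ J : Ideal P, J.FG ∧ J ≤ RingHom.ker f ∧
      RingHom.ker (Algebra.TensorProduct.map (AlgHom.id A R) f) ≤
        J.map (Algebra.TensorProduct.includeRight : P →ₐ[A] R ⊗[A] P) := by
  have hfg : (RingHom.ker (Algebra.TensorProduct.map (AlgHom.id R R) f).toRingHom).FG :=
    Algebra.FinitePresentation.ker_fG_of_surjective _ (LinearMap.lTensor_surjective R hf)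
  have hker := Algebra.TensorProduct.lTensor_ker (A := R) f hf
  change (RingHom.ker (Algebra.TensorProduct.map (AlgHom.id A R) f)).FG at hfg
  rw [hker] at hfg
  classical
  obtain ⟨s, hs, hspan⟩ := (Submodule.fg_span_iff_fg_span_finset_subset _).mp hfg
  obtain ⟨t, ht, rfl⟩ := Finset.subset_set_image_iff.mp hs
  refine ⟨Ideal.span t, ⟨t, rfl⟩, Ideal.span_le.mpr ht, ?_⟩
  rw [hker, Ideal.map_span]
  refine (le_of_eq hspan).trans ?_
  simp

lemma Ideal.Quotient.lTensor_liftₐ_injective {P : Type*} [CommRing P] [Algebra A P]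
    (f : P →ₐ[A] S) (J : Ideal P) (hJ : J ≤ RingHom.ker f)
    (hker : RingHom.ker (Algebra.TensorProduct.map (AlgHom.id A R) f) ≤
      J.map (Algebra.TensorProduct.includeRight : P →ₐ[A] R ⊗[A] P)) :
    Function.Injective ((Ideal.Quotient.liftₐ J f hJ).toLinearMap.lTensor R) := by
  rw [injective_iff_map_eq_zero]
  intro x hx
  obtain ⟨y, rfl⟩ := LinearMap.lTensor_surjective R
    (g := (Ideal.Quotient.mkₐ A J).toLinearMap) (Ideal.Quotient.mkₐ_surjective A J) x
  rw [← LinearMap.lTensor_comp_apply] at hx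
  have hle : J.map (Algebra.TensorProduct.includeRight : P →ₐ[A] R ⊗[A] P) ≤
      RingHom.ker (Algebra.TensorProduct.map (AlgHom.id A R) (Ideal.Quotient.mkₐ A J)) := by
    rw [Ideal.map_le_iff_le_comap]
    intro a ha
    simp [Ideal.Quotient.eq_zero_iff_mem.mpr ha]
  exact hle (hker hx)

end BaseChange

section FiberProduct

variable {A B C K : Type*} [CommRing A] [CommRing B] [CommRing C] [CommRing K]
  [Algebra A B] [Algebra A C] [Algebra A K] [Algebra B K] [Algebra C K]
  [IsScalarTower A B K] [IsScalarTower A C K]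

/-- A module over a fiber product `A = B ×_K C` with `C → K` surjective vanishes if its base
changes to `B` and to `C` vanish. -/
lemma subsingleton_of_subsingleton_tensorProduct_of_fiberProduct
    (hsurj : Function.Surjective (algebraMap C K))
    (hpull : ∀ (b : B) (c : C), algebraMap B K b = algebraMap C K c →
      ∃! a : A, algebraMap A B a = b ∧ algebraMap A C a = c)
    (M : Type*) [AddCommGroup M] [Module A M]
    [Subsingleton (B ⊗[A] M)] [Subsingleton (C ⊗[A] M)] : Subsingleton M := by
  have hinj {a a' : A} (hb : algebraMap A B a = algebraMap A B a')
      (hc : algebraMap A C a = algebraMap A C a') : a = a' :=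
    (hpull (algebraMap A B a') (algebraMap A C a') (by
      rw [← IsScalarTower.algebraMap_apply, ← IsScalarTower.algebraMap_apply])).unique
      ⟨hb, hc⟩ ⟨rfl, rfl⟩
  have hAB : Function.Surjective (algebraMap A B) := fun b ↦ by
    obtain ⟨c, hc⟩ := hsurj (algebraMap B K b)
    obtain ⟨a, ha, -⟩ := hpull b c hc.symm
    exact ⟨a, ha.1⟩
  -- The kernel of `A → B` is a `C`-module, so it annihilates `M`.
  have hsmul (i : A) (hi : algebraMap A B i = 0) (m : M) : i • m = 0 := by
    have hiK : algebraMap C K (algebraMap A C i) = 0 := by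
      rw [← IsScalarTower.algebraMap_apply, IsScalarTower.algebraMap_apply A B K, hi, map_zero]
    choose g hgB hgC using fun c : C ↦ (hpull 0 (c * algebraMap A C i) (by
      rw [map_mul, hiK, mul_zero, map_zero])).exists
    let gₗ : C →ₗ[A] A :=
      { toFun := g
        map_add' := fun x y ↦ hinj (by simp [hgB]) (by simp [hgC, add_mul])
        map_smul' := fun a x ↦ hinj (by simp [hgB])
          (by simp [hgC, Algebra.smul_def, mul_assoc]) }
    have hg : gₗ 1 = i := hinj (by simp [gₗ, hgB, hi]) (by simp [gₗ, hgC])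
    have := congrArg ((TensorProduct.lid A M).toLinearMap ∘ₗ gₗ.rTensor M)
      (Subsingleton.elim ((1 : C) ⊗ₜ[A] m) 0)
    simpa [hg] using this
  let I := RingHom.ker (algebraMap A B)
  have htop : I • (⊤ : Submodule A M) = ⊥ := by
    rw [eq_bot_iff, Submodule.smul_le]
    exact fun i hi m _ ↦ hsmul i hi m
  let e : (A ⧸ I) ≃ₐ[A] B := Ideal.quotientKerAlgEquivOfSurjective (f := Algebra.ofId A B) hAB
  have : Subsingleton (M ⧸ (I • (⊤ : Submodule A M))) :=
    ((TensorProduct.quotTensorEquivQuotSMul M I).symm ≪≫ₗ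
      TensorProduct.congr e.toLinearEquiv (.refl A M)).toEquiv.subsingleton
  rw [Submodule.Quotient.subsingleton_iff, htop] at this
  exact (Submodule.subsingleton_iff A).mp (subsingleton_of_bot_eq_top this)

end FiberProduct

/-- Descent of finite presentation for flat algebras through a Ferrand fiber
product: if `A'` is `A`-flat and `B ⊗_A A'`, `C ⊗_A A'` are finitely presented
algebras, then `A'` is a finitely presented `A`-algebra. -/
theorem ferrand_descent_finitePresentation
    (A B C K : Type*) [CommRing A] [CommRing B] [CommRing C] [CommRing K]
    [Algebra A B] [Algebra A C] [Algebra A K] [Algebra B K] [Algebra C K]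
    [IsScalarTower A B K] [IsScalarTower A C K]
    (hsurj : Function.Surjective (algebraMap C K))
    (hpull : ∀ (b : B) (c : C), algebraMap B K b = algebraMap C K c →
      ∃! a : A, algebraMap A B a = b ∧ algebraMap A C a = c)
    (A' : Type*) [CommRing A'] [Algebra A A'] [Module.Flat A A']
    (hB : Algebra.FinitePresentation B (B ⊗[A] A'))
    (hC : Algebra.FinitePresentation C (C ⊗[A] A')) :
    Algebra.FinitePresentation A A' := by
  have : Algebra.FiniteType A A' := by
    obtain ⟨S, hS, hSB⟩ :=
      Algebra.FiniteType.exists_subalgebra_fg_lTensor_surjective (A := A) (S := A') B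
    obtain ⟨T, hT, hTC⟩ :=
      Algebra.FiniteType.exists_subalgebra_fg_lTensor_surjective (A := A) (S := A') C
    let φ := (S ⊔ T).val.toLinearMap
    have := φ.subsingleton_tensorProduct_quotient_range B
      (Subalgebra.lTensor_val_surjective_mono B le_sup_left hSB)
    have := φ.subsingleton_tensorProduct_quotient_range C
      (Subalgebra.lTensor_val_surjective_mono C le_sup_right hTC)
    have := subsingleton_of_subsingleton_tensorProduct_of_fiberProduct hsurj hpull
      (A' ⧸ LinearMap.range φ)
    rw [Submodule.Quotient.subsingleton_iff, LinearMap.range_eq_top] at this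
    have htop : S ⊔ T = ⊤ := by
      rw [← Subalgebra.range_val (S ⊔ T)]
      exact (AlgHom.range_eq_top _).mpr this
    exact ⟨htop ▸ hS.sup hT⟩
  obtain ⟨n, f, hf⟩ := Algebra.FiniteType.iff_quotient_mvPolynomial''.mp this
  obtain ⟨J, hJ, hJf, hJB⟩ :=
    Algebra.FinitePresentation.exists_fg_le_ker_map_includeRight B f hf
  obtain ⟨L, hL, hLf, hLC⟩ :=
    Algebra.FinitePresentation.exists_fg_le_ker_map_includeRight C f hf
  have hle : J ⊔ L ≤ RingHom.ker f := sup_le hJf hLf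
  let φ := Ideal.Quotient.liftₐ (J ⊔ L) f hle
  have hφ : Function.Surjective φ := Ideal.Quotient.lift_surjective_of_surjective _ hle hf
  have := φ.toLinearMap.subsingleton_tensorProduct_ker B hφ
    (Ideal.Quotient.lTensor_liftₐ_injective B f _ hle (hJB.trans (Ideal.map_mono le_sup_left)))
  have := φ.toLinearMap.subsingleton_tensorProduct_ker C hφ
    (Ideal.Quotient.lTensor_liftₐ_injective C f _ hle (hLC.trans (Ideal.map_mono le_sup_right)))
  have := subsingleton_of_subsingleton_tensorProduct_of_fiberProduct hsurj hpull
    (LinearMap.ker φ.toLinearMap)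
  rw [Submodule.subsingleton_iff_eq_bot, LinearMap.ker_eq_bot] at this
  have : Algebra.FinitePresentation A (MvPolynomial (Fin n) A ⧸ (J ⊔ L)) :=
    .quotient (Submodule.FG.sup hJ hL)
  exact .equiv (AlgEquiv.ofBijective φ ⟨‹_›, hφ⟩)
end

section
/- Let k be a field, B = k[x]_(x) the localization of k[x] at (x), K = k(x), C = K[y]_(y), with C → K the reduction modulo y and B → K the inclusion. Then A = B ×_K C is a valuation ring (of the field k(x,y)). -/
open Polynomial

/-- The canonical map from `B = k[x]_(x)` to its fraction field `K = k(x)`. -/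
noncomputable def dvrToFracField (k : Type*) [Field k]
    [hp : (Ideal.span {(X : k[X])}).IsPrime] :
    Localization.AtPrime (Ideal.span {(X : k[X])}) →+* RatFunc k :=
  IsLocalization.map (M := (Ideal.span {(X : k[X])}).primeCompl)
    (T := nonZeroDivisors k[X]) (RatFunc k) (RingHom.id k[X])
    (by
      intro x hx
      exact mem_nonZeroDivisors_of_ne_zero (fun h => hx (h ▸ Ideal.zero_mem _)))

/-- The residue map `C = K[y]_(y) → K`, reduction modulo `y`. -/
noncomputable def resModY (k : Type*) [Field k]
    [hq : (Ideal.span {(X : (RatFunc k)[X])}).IsPrime] :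
    Localization.AtPrime (Ideal.span {(X : (RatFunc k)[X])}) →+* RatFunc k :=
  IsLocalization.lift (M := (Ideal.span {(X : (RatFunc k)[X])}).primeCompl)
    (g := Polynomial.evalRingHom (0 : RatFunc k))
    (fun y => isUnit_iff_ne_zero.mpr fun h => y.2 (Ideal.mem_span_singleton.mpr
      (Polynomial.X_dvd_iff.mpr (by rw [Polynomial.coeff_zero_eq_eval_zero]; simpa using h))))

/-- `A = B ×_K C`, realized as the preimage of `B` under `C → K`. -/
noncomputable def compositionRing (k : Type*) [Field k]
    [hp : (Ideal.span {(X : k[X])}).IsPrime]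
    [hq : (Ideal.span {(X : (RatFunc k)[X])}).IsPrime] :
    Subring (Localization.AtPrime (Ideal.span {(X : (RatFunc k)[X])})) :=
  Subring.comap (resModY k) (dvrToFracField k).range

/-- Let `C` be a valuation ring and `f : C → K` a ring homomorphism to a field that kills all
nonunits. The preimage under `f` of a valuation subring of `K` is a valuation ring. -/
theorem ValuationRing.comap_of_forall_not_isUnit {C K : Type*} [CommRing C] [IsDomain C]
    [ValuationRing C] [Field K] (f : C →+* K) (hf : ∀ c, ¬IsUnit c → f c = 0) (S : Subring K)
    (hS : ∀ x, x ∈ S ∨ x⁻¹ ∈ S) : ValuationRing (S.comap f) := by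
  have key : ∀ (a b : S.comap f) (c : C), (a : C) * c = b →
      ∃ d : S.comap f, a * d = b ∨ b * d = a := by
    intro a b c h
    by_cases hc : IsUnit c
    · obtain ⟨u, rfl⟩ := hc
      rcases hS (f u) with hu | hu
      · exact ⟨⟨u, hu⟩, Or.inl (Subtype.ext h)⟩
      · refine ⟨⟨(u⁻¹ : Cˣ), ?_⟩, Or.inr (Subtype.ext ?_)⟩
        · rwa [Subring.mem_comap, map_units_inv]
        · simp [← h]
    · exact ⟨⟨c, by rw [Subring.mem_comap, hf c hc]; exact S.zero_mem⟩, Or.inl (Subtype.ext h)⟩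
  refine { cond' := fun a b => ?_ }
  obtain ⟨c, h | h⟩ := ValuationRing.cond (a : C) (b : C)
  · exact key a b c h
  · obtain ⟨d, hd⟩ := key b a c h
    exact ⟨d, hd.symm⟩

/-- The localization of `F[X]` at the prime `(X)` is a valuation ring. -/
theorem valuationRing_localization_span_X (F : Type*) [Field F]
    [hp : (Ideal.span {(X : F[X])}).IsPrime] :
    ValuationRing (Localization.AtPrime (Ideal.span {(X : F[X])})) := by
  have := IsLocalization.AtPrime.isDiscreteValuationRing_of_dedekind_domain F[X]
    (P := Ideal.span {(X : F[X])}) (by simp)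
    (Localization.AtPrime (Ideal.span {(X : F[X])}))
  infer_instance

theorem mem_range_dvrToFracField_or_inv_mem (k : Type*) [Field k]
    [hp : (Ideal.span {(X : k[X])}).IsPrime] (x : RatFunc k) :
    x ∈ (dvrToFracField k).range ∨ x⁻¹ ∈ (dvrToFracField k).range := by
  have := valuationRing_localization_span_X k
  have hmap (p : k[X]) : dvrToFracField k (algebraMap _ _ p) = algebraMap k[X] (RatFunc k) p :=
    IsLocalization.map_eq _ p
  by_cases hx : x = 0
  · exact Or.inl (hx ▸ Subring.zero_mem _)
  have hd : algebraMap k[X] (RatFunc k) x.denom ≠ 0 := RatFunc.algebraMap_ne_zero x.denom_ne_zero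
  have hn : algebraMap k[X] (RatFunc k) x.num ≠ 0 :=
    RatFunc.algebraMap_ne_zero (RatFunc.num_ne_zero hx)
  obtain ⟨c, h | h⟩ := ValuationRing.cond
    (algebraMap k[X] (Localization.AtPrime (Ideal.span {(X : k[X])})) x.num)
    (algebraMap k[X] _ x.denom)
  all_goals
    have h' := congrArg (dvrToFracField k) h
    rw [map_mul, hmap, hmap] at h'
  · refine Or.inr ⟨c, ?_⟩
    rw [← RatFunc.num_div_denom x, inv_div, eq_div_iff hn, mul_comm, h']
  · refine Or.inl ⟨c, ?_⟩
    rw [← RatFunc.num_div_denom x, eq_div_iff hd, mul_comm, h']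

theorem resModY_eq_zero_of_not_isUnit (k : Type*) [Field k]
    [hq : (Ideal.span {(X : (RatFunc k)[X])}).IsPrime]
    (c : Localization.AtPrime (Ideal.span {(X : (RatFunc k)[X])})) (hc : ¬IsUnit c) :
    resModY k c = 0 := by
  obtain ⟨p, s, rfl⟩ :=
    IsLocalization.exists_mk'_eq (Ideal.span {(X : (RatFunc k)[X])}).primeCompl c
  rw [IsLocalization.AtPrime.isUnit_mk'_iff _ (Ideal.span {(X : (RatFunc k)[X])}),
    Ideal.mem_primeCompl_iff, not_not, Ideal.mem_span_singleton, X_dvd_iff,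
    coeff_zero_eq_eval_zero] at hc
  rw [resModY, IsLocalization.lift_mk'_spec, mul_zero]
  exact hc

/-- The composition `A = B ×_K C` of the two discrete valuation rings
`B = k[x]_(x)` (with fraction field `K = k(x)`) and `C = K[y]_(y)`
(with residue field `K`) is a valuation ring. -/
theorem composition_is_valuation_ring (k : Type*) [Field k]
    [hp : (Ideal.span {(X : k[X])}).IsPrime]
    [hq : (Ideal.span {(X : (RatFunc k)[X])}).IsPrime] :
    ValuationRing (compositionRing k) := by
  have := valuationRing_localization_span_X (RatFunc k)
  exact ValuationRing.comap_of_forall_not_isUnit (resModY k) (resModY_eq_zero_of_not_isUnit k)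
    (dvrToFracField k).range (mem_range_dvrToFracField_or_inv_mem k)
end
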